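/- arXiv:1911.01991 — 4 statements merged into one kernel-verified Lean document; each statement's English description precedes it below -/
import Mathlib

section
/- For every constant C > 0, the function f_C : (0, ∞) → ℂ defined by f_C(r) = 1/(C r² + 1) is differentiable, is real-valued, satisfies r · f_C′(r) = 2·((conj (f_C r))² − f_C r) for every r > 0, and satisfies f_C(r) → 1 as r → 0⁺ and f_C(r) → 0 as r → ∞. -/
open Filter

theorem hasDerivAt_one_div_mul_sq_add_one {C : ℝ} (hC : 0 ≤ C) (r : ℝ) :
    HasDerivAt (fun x : ℝ => 1 / (C * x ^ 2 + 1)) (-(2 * C * r) / (C * r ^ 2 + 1) ^ 2) r := by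
  have h : C * r ^ 2 + 1 ≠ 0 := by positivity
  have hd : HasDerivAt (fun x : ℝ => C * x ^ 2 + 1) (2 * C * r) r := by
    refine (((hasDerivAt_pow 2 r).const_mul C).add_const 1).congr_deriv ?_
    push_cast
    ring
  simpa only [one_div] using hd.fun_inv h

theorem tendsto_one_div_mul_sq_add_one_atTop {C : ℝ} (hC : 0 < C) :
    Tendsto (fun x : ℝ => 1 / (C * x ^ 2 + 1)) atTop (nhds 0) := by
  simp only [one_div]
  exact tendsto_inv_atTop_zero.comp <| tendsto_atTop_add_const_right _ _ <|
    (tendsto_pow_atTop two_ne_zero).const_mul_atTop hC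

/-- For every `C > 0`, the function `f_C(r) = 1/(C r² + 1)` on `(0, ∞)`
is differentiable, real-valued, satisfies the invariant `G₂`-instanton ODE
`r · f_C′(r) = 2·((conj (f_C r))² − f_C r)` for every `r > 0`, and satisfies
`f_C(r) → 1` as `r → 0⁺` and `f_C(r) → 0` as `r → ∞`. -/
theorem standard_instanton_solution (C : ℝ) (hC : 0 < C)
    (f : ℝ → ℂ) (hf : ∀ r : ℝ, f r = 1 / ((C : ℂ) * (r : ℂ) ^ 2 + 1)) :
    (∀ r ∈ Set.Ioi (0 : ℝ), DifferentiableAt ℝ f r) ∧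
    (∀ r ∈ Set.Ioi (0 : ℝ), (f r).im = 0) ∧
    (∀ r ∈ Set.Ioi (0 : ℝ),
      (r : ℂ) * deriv f r = 2 * ((starRingEnd ℂ (f r)) ^ 2 - f r)) ∧
    Tendsto f (nhdsWithin 0 (Set.Ioi 0)) (nhds 1) ∧
    Tendsto f atTop (nhds 0) := by
  have hfun : f = fun r : ℝ => ((1 / (C * r ^ 2 + 1) : ℝ) : ℂ) := by
    funext r
    rw [hf]
    push_cast
    rfl
  have hderiv (r : ℝ) :
      HasDerivAt f ((-(2 * C * r) / (C * r ^ 2 + 1) ^ 2 : ℝ) : ℂ) r := by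
    rw [hfun]
    exact (hasDerivAt_one_div_mul_sq_add_one hC.le r).ofReal_comp
  refine ⟨fun r _ => (hderiv r).differentiableAt, fun r _ => ?_, fun r _ => ?_, ?_, ?_⟩
  · rw [hfun]
    exact Complex.ofReal_im _
  · rw [(hderiv r).deriv, hfun]
    simp only [Complex.conj_ofReal]
    norm_cast
    have h : C * r ^ 2 + 1 ≠ 0 := by positivity
    field_simp
    ring
  · have h : f 0 = 1 := by simp [hf]
    rw [← h]
    exact (hderiv 0).continuousAt.continuousWithinAt
  · rw [hfun, ← Complex.ofReal_zero]
    exact (Complex.continuous_ofReal.tendsto 0).comp (tendsto_one_div_mul_sq_add_one_atTop hC)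
end

section
/- Let f : (0, ∞) → ℂ be differentiable and satisfy r · f′(r) = 2·((conj (f r))² − f r) for all r > 0, together with the boundary conditions f(r) → 1 as r → 0⁺ and f(r) → 0 as r → ∞. Then there exists a constant C > 0 such that f(r) = 1/(C r² + 1) for all r > 0. -/
open Filter

/-- A solution of a scalar linear homogeneous ODE on the half-line that vanishes at one point
vanishes identically. -/
theorem eq_zero_of_hasDerivAt_mul_self {a g : ℝ → ℝ} (ha : ContinuousOn a (Set.Ioi 0))
    (hg : ∀ r ∈ Set.Ioi (0 : ℝ), HasDerivAt g (a r * g r) r) {c : ℝ} (hc : 0 < c)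
    (hgc : g c = 0) {r : ℝ} (hr : 0 < r) : g r = 0 := by
  have hA : ∀ s ∈ Set.Ioi (0 : ℝ), HasDerivAt (fun s => ∫ t in c..s, a t) (a s) s := by
    intro s hs
    refine intervalIntegral.integral_hasDerivAt_right ?_ ?_ (ha.continuousAt (Ioi_mem_nhds hs))
    · refine (ha.mono fun t ht => ?_).intervalIntegrable
      exact lt_of_lt_of_le (lt_min hc hs) ht.1
    · exact ha.stronglyMeasurableAtFilter isOpen_Ioi s hs
  have hG : ∀ s ∈ Set.Ioi (0 : ℝ),
      HasDerivAt (fun s => g s * Real.exp (-∫ t in c..s, a t)) 0 s := by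
    intro s hs
    refine HasDerivAt.congr_deriv ((hg s hs).mul (hA s hs).neg.exp) ?_
    simp only [Pi.neg_apply]
    ring
  have hconst := isOpen_Ioi.is_const_of_deriv_eq_zero (convex_Ioi (0 : ℝ)).isPreconnected
    (fun s hs => (hG s hs).differentiableAt.differentiableWithinAt)
    (fun s hs => (hG s hs).deriv) hr hc
  simpa [hgc, (Real.exp_pos _).ne'] using hconst

/-- A solution of `g' = a g` on the half-line with `a ≤ 0` near `0` and `g → 0` at `0` has a zero. -/
theorem exists_eq_zero_of_hasDerivAt_nonpos_mul {a g : ℝ → ℝ}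
    (hg : ∀ r ∈ Set.Ioi (0 : ℝ), HasDerivAt g (a r * g r) r)
    (ha : ∀ᶠ r in nhdsWithin 0 (Set.Ioi 0), a r ≤ 0)
    (h0 : Tendsto g (nhdsWithin 0 (Set.Ioi 0)) (nhds 0)) : ∃ c, 0 < c ∧ g c = 0 := by
  obtain ⟨d, hd, hda⟩ := mem_nhdsGT_iff_exists_Ioo_subset.1 ha
  have hd : 0 < d := hd
  have hsq : ∀ r ∈ Set.Ioi (0 : ℝ), HasDerivAt (fun r => g r ^ 2) (2 * a r * g r ^ 2) r := by
    intro r hr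
    refine HasDerivAt.congr_deriv ((hg r hr).pow 2) ?_
    norm_num
    ring
  have hanti : AntitoneOn (fun r => g r ^ 2) (Set.Ioo 0 d) := by
    refine antitoneOn_of_deriv_nonpos (convex_Ioo 0 d)
      (fun r hr => (hsq r hr.1).continuousAt.continuousWithinAt)
      (fun r hr => ?_) (fun r hr => ?_)
    · rw [interior_Ioo] at hr
      exact (hsq r hr.1).differentiableAt.differentiableWithinAt
    · rw [interior_Ioo] at hr
      rw [(hsq r hr.1).deriv]
      have : a r ≤ 0 := hda hr
      nlinarith [sq_nonneg (g r)]
  have hmid : d / 2 ∈ Set.Ioo 0 d := ⟨by linarith, by linarith⟩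
  refine ⟨d / 2, hmid.1, ?_⟩
  have hle : g (d / 2) ^ 2 ≤ 0 := by
    refine ge_of_tendsto (by simpa using h0.pow 2) ?_
    filter_upwards [Ioo_mem_nhdsGT hmid.1] with r hr
    exact hanti ⟨hr.1, hr.2.trans hmid.2⟩ hmid hr.2.le
  exact pow_eq_zero_iff two_ne_zero |>.1 (le_antisymm hle (sq_nonneg _))

/-- The real solutions of `r x' = 2 x (x - 1)` on the half-line which are not identically zero are
the functions `1 / (C r² + 1)`. -/
theorem exists_inv_eq_of_hasDerivAt {x : ℝ → ℝ}
    (hx : ∀ r ∈ Set.Ioi (0 : ℝ), HasDerivAt x (2 * (x r - 1) / r * x r) r)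
    {c : ℝ} (hc : 0 < c) (hxc : x c ≠ 0) :
    ∃ C : ℝ, ∀ r ∈ Set.Ioi (0 : ℝ), x r ≠ 0 ∧ (x r)⁻¹ = C * r ^ 2 + 1 := by
  have hcont : ContinuousOn (fun r => 2 * (x r - 1) / r) (Set.Ioi 0) := by
    intro r hr
    have h := (hx r hr).continuousAt
    have hr' : r ≠ 0 := ne_of_gt hr
    exact ContinuousAt.continuousWithinAt (by fun_prop (disch := assumption))
  have hne : ∀ r ∈ Set.Ioi (0 : ℝ), x r ≠ 0 := fun r hr h =>
    hxc (eq_zero_of_hasDerivAt_mul_self hcont hx hr h hc)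
  have hq : ∀ r ∈ Set.Ioi (0 : ℝ), HasDerivAt (fun r => ((x r)⁻¹ - 1) / r ^ 2) 0 r := by
    intro r hr
    have hr' : r ≠ 0 := ne_of_gt hr
    have hxr := hne r hr
    refine HasDerivAt.congr_deriv ((((hx r hr).inv hxr).sub_const 1).div
      (hasDerivAt_pow 2 r) (pow_ne_zero 2 hr')) ?_
    simp only [Pi.inv_apply]
    field_simp
    ring
  obtain ⟨C, hC⟩ := isOpen_Ioi.exists_is_const_of_deriv_eq_zero
    (convex_Ioi (0 : ℝ)).isPreconnected
    (fun s hs => (hq s hs).differentiableAt.differentiableWithinAt)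
    (fun s hs => (hq s hs).deriv)
  refine ⟨C, fun r hr => ⟨hne r hr, ?_⟩⟩
  have hr' : r ≠ 0 := ne_of_gt hr
  have := hC r hr
  rw [div_eq_iff (pow_ne_zero 2 hr')] at this
  linarith

/-- If `f : (0,∞) → ℂ` is differentiable, satisfies the invariant
`G₂`-instanton ODE `r · f′(r) = 2·((conj (f r))² − f r)` for all `r > 0`, and satisfies
the boundary conditions `f(r) → 1` as `r → 0⁺` and `f(r) → 0` as `r → ∞`, then there is a
constant `C > 0` with `f(r) = 1/(C r² + 1)` for all `r > 0`. -/
theorem uniqueness_of_standard_instanton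
    (f : ℝ → ℂ) (hdiff : ∀ r ∈ Set.Ioi (0 : ℝ), DifferentiableAt ℝ f r)
    (hode : ∀ r ∈ Set.Ioi (0 : ℝ),
      (r : ℂ) * deriv f r = 2 * ((starRingEnd ℂ (f r)) ^ 2 - f r))
    (h0 : Tendsto f (nhdsWithin 0 (Set.Ioi 0)) (nhds 1))
    (hinf : Tendsto f atTop (nhds 0)) :
    ∃ C : ℝ, 0 < C ∧ ∀ r ∈ Set.Ioi (0 : ℝ),
      f r = 1 / ((C : ℂ) * (r : ℂ) ^ 2 + 1) := by
  have hder : ∀ r ∈ Set.Ioi (0 : ℝ),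
      HasDerivAt f ((2 / r : ℝ) • ((starRingEnd ℂ (f r)) ^ 2 - f r)) r := by
    intro r hr
    have hr' : (r : ℂ) ≠ 0 := Complex.ofReal_ne_zero.2 (ne_of_gt hr)
    refine HasDerivAt.congr_deriv (hdiff r hr).hasDerivAt ?_
    rw [Complex.real_smul, Complex.ofReal_div, div_mul_eq_mul_div, eq_div_iff hr',
      mul_comm (deriv f r), hode r hr, Complex.ofReal_ofNat]
  have hre : ∀ r ∈ Set.Ioi (0 : ℝ), HasDerivAt (fun r => (f r).re)
      (2 / r * ((f r).re ^ 2 - (f r).im ^ 2 - (f r).re)) r := by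
    intro r hr
    refine HasDerivAt.congr_deriv (Complex.reCLM.hasFDerivAt.comp_hasDerivAt r (hder r hr)) ?_
    simp [pow_two]
  have him : ∀ r ∈ Set.Ioi (0 : ℝ), HasDerivAt (fun r => (f r).im)
      (-(2 * (2 * (f r).re + 1) / r) * (f r).im) r := by
    intro r hr
    refine HasDerivAt.congr_deriv (Complex.imCLM.hasFDerivAt.comp_hasDerivAt r (hder r hr)) ?_
    simp [pow_two]
    ring
  have hre0 : Tendsto (fun r => (f r).re) (nhdsWithin 0 (Set.Ioi 0)) (nhds 1) := by
    simpa [Function.comp_def] using (Complex.continuous_re.tendsto 1).comp h0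
  have him0 : Tendsto (fun r => (f r).im) (nhdsWithin 0 (Set.Ioi 0)) (nhds 0) := by
    simpa [Function.comp_def] using (Complex.continuous_im.tendsto 1).comp h0
  have hreinf : Tendsto (fun r => (f r).re) atTop (nhds 0) := by
    simpa [Function.comp_def] using (Complex.continuous_re.tendsto 0).comp hinf
  have hpos : ∀ᶠ r in nhdsWithin 0 (Set.Ioi 0), 0 < r ∧ 0 < (f r).re :=
    (eventually_mem_nhdsWithin (a := (0 : ℝ))).and (hre0.eventually_const_lt one_pos)
  have hreal : ∀ r ∈ Set.Ioi (0 : ℝ), (f r).im = 0 := by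
    obtain ⟨c, hc, hfc⟩ := exists_eq_zero_of_hasDerivAt_nonpos_mul him
      (hpos.mono fun r hr => by
        obtain ⟨hr, hfr⟩ := hr
        exact neg_nonpos.2 (by positivity)) him0
    refine fun r hr => eq_zero_of_hasDerivAt_mul_self (fun s hs => ?_) him hc hfc hr
    have h := (hre s hs).continuousAt
    have hs' : s ≠ 0 := ne_of_gt hs
    exact ContinuousAt.continuousWithinAt (by fun_prop (disch := assumption))
  obtain ⟨c, hc, hfc⟩ := hpos.exists
  obtain ⟨C, hC⟩ := exists_inv_eq_of_hasDerivAt (x := fun r => (f r).re)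
    (fun r hr => by
      refine HasDerivAt.congr_deriv (hre r hr) ?_
      rw [hreal r hr]
      ring) hc hfc.ne'
  refine ⟨C, ?_, fun r hr => ?_⟩
  · rcases lt_trichotomy C 0 with hneg | rfl | h
    · have hs : (0 : ℝ) < √(-C⁻¹) := Real.sqrt_pos.2 (neg_pos.2 (inv_lt_zero.2 hneg))
      obtain ⟨hne, heq⟩ := hC _ hs
      rw [Real.sq_sqrt (Real.sqrt_pos.1 hs).le, mul_neg, mul_inv_cancel₀ hneg.ne,
        neg_add_cancel] at heq
      exact absurd heq (inv_ne_zero hne)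
    · have hone : (fun r => (f r).re) =ᶠ[atTop] fun _ => 1 := by
        filter_upwards [eventually_gt_atTop 0] with r hr
        simpa using (hC r hr).2
      exact absurd (tendsto_nhds_unique hreinf (tendsto_const_nhds.congr' hone.symm)) zero_ne_one
    · exact h
  · have hval : (f r).re = 1 / (C * r ^ 2 + 1) := by rw [← (hC r hr).2, one_div, inv_inv]
    rw [← Complex.re_add_im (f r), hreal r hr, hval]
    push_cast
    ring
end

section
/- Let M be the 10 × 10 complex matrix given below (the matrix of the twisted Dirac operator (D⁰_{A_can})_γ on Hom(V_{(1,0)} ⊗ S, 𝔤₂)_{SU(3)} for the standard representation γ = (1,0) of G₂). Then the characteristic polynomial of M equals (X² − 1)·(X² + X − 8)²·(X² − X − 8)²; equivalently, the eigenvalues of M are real and symmetric about 0, and the nonnegative eigenvalues with their algebraic multiplicities are: 1 (multiplicity 1), (−1 + √33)/2 (multiplicity 2), and (1 + √33)/2 (multiplicity 2), with the negatives of these occurring with the same multiplicities. -/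
open Polynomial Complex

/-- The `4 × 4` diagonal block of the Dirac matrix, with the imaginary unit replaced by `ω`. -/
noncomputable def diracBlock (ω : ℂ) : Matrix (Fin 4) (Fin 4) ℂ :=
  !![-3, -1, -4, 0;
     -1, 0, 8, -ω;
     -1/4, 1/2, 0, ω/4;
     0, ω, -4*ω, 3]

/-- The splitting of the ten basis vectors into the three invariant subsets. -/
def diracIndexEquiv : (Fin 4 ⊕ Fin 4) ⊕ Fin 2 ≃ Fin 10 where
  toFun := Sum.elim (Sum.elim ![0, 2, 5, 8] ![1, 3, 4, 9]) ![6, 7]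
  invFun := ![.inl (.inl 0), .inl (.inr 0), .inl (.inl 1), .inl (.inr 1), .inl (.inr 2),
    .inl (.inl 2), .inr 0, .inr 1, .inl (.inl 3), .inl (.inr 3)]
  left_inv := by decide
  right_inv := by decide

theorem charpoly_diracBlock {ω : ℂ} (hω : ω ^ 2 = -1) :
    (diracBlock ω).charpoly = (X ^ 2 + X - 8) * (X ^ 2 - X - 8) := by
  refine Polynomial.funext fun t => ?_
  rw [Matrix.eval_charpoly]
  simp [diracBlock, Matrix.det_succ_row_zero, Fin.sum_univ_succ, Fin.succAbove, Matrix.scalar_apply,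
    Matrix.diagonal_apply]
  linear_combination (2 * t ^ 2 + 2 * t - 16) * hω

theorem charpoly_swap :
    (!![0, 1; 1, 0] : Matrix (Fin 2) (Fin 2) ℂ).charpoly = X ^ 2 - 1 := by
  simp [Matrix.charpoly_fin_two, Matrix.trace_fin_two, Matrix.det_fin_two, sub_eq_add_neg]

/-- The matrix of the twisted Dirac operator `(D⁰_{A_can})_γ` for the
standard representation `γ = (1,0)` of `G₂` has characteristic polynomial
`(X² − 1)·(X² + X − 8)²·(X² − X − 8)²`; equivalently, its eigenvalues are real and
symmetric about `0`, with nonnegative eigenvalues `1` (multiplicity 1),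
`(−1 + √33)/2` (multiplicity 2) and `(1 + √33)/2` (multiplicity 2). -/
theorem dirac_matrix_standard_rep_charpoly :
    (!![-3, 0, -1, 0, 0, -4, 0, 0, 0, 0;
        0, -3, 0, -1, -4, 0, 0, 0, 0, 0;
        -1, 0, 0, 0, 0, 8, 0, 0, -I, 0;
        0, -1, 0, 0, 8, 0, 0, 0, 0, I;
        0, -1/4, 0, 1/2, 0, 0, 0, 0, 0, -I/4;
        -1/4, 0, 1/2, 0, 0, 0, 0, 0, I/4, 0;
        0, 0, 0, 0, 0, 0, 0, 1, 0, 0;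
        0, 0, 0, 0, 0, 0, 1, 0, 0, 0;
        0, 0, I, 0, 0, -4*I, 0, 0, 3, 0;
        0, 0, 0, -I, 4*I, 0, 0, 0, 0, 3] : Matrix (Fin 10) (Fin 10) ℂ).charpoly =
      (X ^ 2 - 1) * (X ^ 2 + X - 8) ^ 2 * (X ^ 2 - X - 8) ^ 2 := by
  have hblocks : !![-3, 0, -1, 0, 0, -4, 0, 0, 0, 0;
        0, -3, 0, -1, -4, 0, 0, 0, 0, 0;
        -1, 0, 0, 0, 0, 8, 0, 0, -I, 0;
        0, -1, 0, 0, 8, 0, 0, 0, 0, I;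
        0, -1/4, 0, 1/2, 0, 0, 0, 0, 0, -I/4;
        -1/4, 0, 1/2, 0, 0, 0, 0, 0, I/4, 0;
        0, 0, 0, 0, 0, 0, 0, 1, 0, 0;
        0, 0, 0, 0, 0, 0, 1, 0, 0, 0;
        0, 0, I, 0, 0, -4*I, 0, 0, 3, 0;
        0, 0, 0, -I, 4*I, 0, 0, 0, 0, 3] =
      Matrix.reindex diracIndexEquiv diracIndexEquiv
        (Matrix.fromBlocks (Matrix.fromBlocks (diracBlock I) 0 0 (diracBlock (-I))) 0 0
          !![0, 1; 1, 0]) := by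
    ext i j
    fin_cases i <;> fin_cases j <;> simp [diracIndexEquiv, diracBlock]
  rw [hblocks, Matrix.charpoly_reindex, Matrix.charpoly_fromBlocks_zero₁₂,
    Matrix.charpoly_fromBlocks_zero₁₂, charpoly_diracBlock I_sq,
    charpoly_diracBlock (by rw [neg_sq, I_sq]), charpoly_swap]
  ring
end

section
/- Let M be the 12 × 12 complex matrix given below (the matrix of the twisted Dirac operator (D⁰_{A_can})_γ on Hom(V_{(0,1)} ⊗ S, 𝔤₂)_{SU(3)} for the adjoint representation γ = (0,1) of G₂). Then the characteristic polynomial of M equals (X² + X − 14)²·(X² − X − 14)²·(X² + X − 9)·(X² − X − 9); equivalently, the eigenvalues of M are real and symmetric about 0, and the nonnegative eigenvalues with their algebraic multiplicities are: (1 + √57)/2 (multiplicity 2), (−1 + √57)/2 (multiplicity 2), (1 + √37)/2 (multiplicity 1), and (−1 + √37)/2 (multiplicity 1), with the negatives of these occurring with the same multiplicities. -/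
open Polynomial Complex

/-- The characteristic polynomial of a block diagonal matrix is the product of the characteristic
polynomials of its blocks. -/
theorem charpoly_blockDiagonal {R m o : Type*} [CommRing R] [Fintype m] [DecidableEq m]
    [Fintype o] [DecidableEq o] (A : o → Matrix m m R) :
    (Matrix.blockDiagonal A).charpoly = ∏ k, (A k).charpoly := by
  have h : (Matrix.blockDiagonal A).charmatrix =
      Matrix.blockDiagonal fun k => (A k).charmatrix := by
    ext ⟨i, k⟩ ⟨j, l⟩
    by_cases hk : k = l <;> by_cases hi : i = j <;> simp [Matrix.blockDiagonal_apply, hk, hi]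
  simp only [Matrix.charpoly, h, Matrix.det_blockDiagonal]

/-- The two blocks with eigenvalues `(±1 ± √57)/2`, given by the two square roots `s` of `-1`. -/
theorem charpoly_block_of_sq_eq_neg_one (s : ℂ) (hs : s ^ 2 = -1) :
    (!![-3, -4, 8, 0; -1, 0, -4, -s; 1/2, -1, 0, -s/2; 0, 4*s, 8*s, 3] :
      Matrix (Fin 4) (Fin 4) ℂ).charpoly = (X ^ 2 + X - 14) * (X ^ 2 - X - 14) := by
  refine Polynomial.funext fun x => ?_
  rw [Matrix.eval_charpoly, Matrix.det_succ_row_zero]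
  simp [Fin.sum_univ_succ, Fin.succAbove, Matrix.det_fin_three, Matrix.scalar_apply,
    Matrix.diagonal_apply]
  ring_nf
  simp only [hs]
  ring_nf

/-- The block with eigenvalues `(±1 ± √37)/2`. -/
theorem charpoly_block_adjoint :
    (!![-3, 1, 1, 0; 3/2, 0, 2, 3*I/2; 3/2, 2, 0, -3*I/2; 0, -I, I, 3] :
      Matrix (Fin 4) (Fin 4) ℂ).charpoly = (X ^ 2 + X - 9) * (X ^ 2 - X - 9) := by
  refine Polynomial.funext fun x => ?_
  rw [Matrix.eval_charpoly, Matrix.det_succ_row_zero]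
  simp [Fin.sum_univ_succ, Fin.succAbove, Matrix.det_fin_three, Matrix.scalar_apply,
    Matrix.diagonal_apply]
  ring_nf
  simp only [I_sq]
  ring_nf

/-- The matrix of the twisted Dirac operator `(D⁰_{A_can})_γ` for the
adjoint representation `γ = (0,1)` of `G₂` has characteristic polynomial
`(X² + X − 14)²·(X² − X − 14)²·(X² + X − 9)·(X² − X − 9)`; equivalently, its eigenvalues
are real and symmetric about `0`, with nonnegative eigenvalues `(1 + √57)/2`
(multiplicity 2), `(−1 + √57)/2` (multiplicity 2), `(1 + √37)/2` (multiplicity 1) and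
`(−1 + √37)/2` (multiplicity 1). -/
theorem dirac_matrix_adjoint_rep_charpoly :
    (!![-3, 0, 0, -4, 0, 0, 8, 0, 0, 0, 0, 0;
        0, -3, 0, 0, -4, 0, 0, 8, 0, 0, 0, 0;
        0, 0, -3, 0, 0, 1, 0, 0, 1, 0, 0, 0;
        -1, 0, 0, 0, 0, 0, -4, 0, 0, -I, 0, 0;
        0, -1, 0, 0, 0, 0, 0, -4, 0, 0, I, 0;
        0, 0, 3/2, 0, 0, 0, 0, 0, 2, 0, 0, 3*I/2;
        1/2, 0, 0, -1, 0, 0, 0, 0, 0, -I/2, 0, 0;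
        0, 1/2, 0, 0, -1, 0, 0, 0, 0, 0, I/2, 0;
        0, 0, 3/2, 0, 0, 2, 0, 0, 0, 0, 0, -3*I/2;
        0, 0, 0, 4*I, 0, 0, 8*I, 0, 0, 3, 0, 0;
        0, 0, 0, 0, -4*I, 0, 0, -8*I, 0, 0, 3, 0;
        0, 0, 0, 0, 0, -I, 0, 0, I, 0, 0, 3] : Matrix (Fin 12) (Fin 12) ℂ).charpoly =
      (X ^ 2 + X - 14) ^ 2 * (X ^ 2 - X - 14) ^ 2 *
        (X ^ 2 + X - 9) * (X ^ 2 - X - 9) := by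
  have hprod : ∀ A B C : Matrix (Fin 4) (Fin 4) ℂ,
      (Matrix.reindex finProdFinEquiv finProdFinEquiv
        (Matrix.blockDiagonal ![A, B, C])).charpoly = A.charpoly * B.charpoly * C.charpoly := by
    intro A B C
    rw [Matrix.charpoly_reindex, charpoly_blockDiagonal, Fin.prod_univ_three]
    rfl
  have h := hprod !![-3, -4, 8, 0; -1, 0, -4, -I; 1/2, -1, 0, -I/2; 0, 4*I, 8*I, 3]
    !![-3, -4, 8, 0; -1, 0, -4, -(-I); 1/2, -1, 0, -(-I)/2; 0, 4*(-I), 8*(-I), 3]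
    !![-3, 1, 1, 0; 3/2, 0, 2, 3*I/2; 3/2, 2, 0, -3*I/2; 0, -I, I, 3]
  rw [charpoly_block_of_sq_eq_neg_one I I_sq,
    charpoly_block_of_sq_eq_neg_one (-I) (by rw [neg_sq, I_sq]), charpoly_block_adjoint] at h
  refine Eq.trans (congrArg Matrix.charpoly ?_) (h.trans (by ring))
  ext i j
  obtain ⟨⟨a, k⟩, rfl⟩ := (finProdFinEquiv (m := 4) (n := 3)).surjective i
  obtain ⟨⟨b, l⟩, rfl⟩ := (finProdFinEquiv (m := 4) (n := 3)).surjective j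
  rw [Matrix.reindex_apply, Matrix.submatrix_apply, Equiv.symm_apply_apply,
    Equiv.symm_apply_apply, Matrix.blockDiagonal_apply]
  fin_cases k <;> fin_cases l <;> fin_cases a <;> fin_cases b <;>
    simp [finProdFinEquiv]
end
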